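/- (Low-frequency maximal estimate) For every φ ∈ S(ℝ) and every 0 < T < 1, ‖P_0 V(t) φ‖_{L^2_x L^∞_T} ≲ ‖P_0 φ‖_{L²(ℝ)}, with implicit constant independent of φ and T. -/

import Mathlib

open MeasureTheory Real Set Filter
open scoped FourierTransform ENNReal NNReal Topology

noncomputable section

/-- Fourier multiplier operator with symbol `m`. -/
def FMul (m : ℝ → ℂ) (f : ℝ → ℂ) : ℝ → ℂ :=
  𝓕⁻ fun ξ => m ξ * 𝓕 f ξ

/-- `D_x^α`, the Fourier multiplier with symbol `|ξ|^α`. -/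
def Dop (α : ℝ) (f : ℝ → ℂ) : ℝ → ℂ :=
  FMul (fun ξ => ((|ξ| ^ α : ℝ) : ℂ)) f

/-- The free Benjamin–Ono group `V(t) = 𝓕⁻¹ e^{itξ|ξ|} 𝓕`. -/
def BOGroup (t : ℝ) (f : ℝ → ℂ) : ℝ → ℂ :=
  FMul (fun ξ => Complex.exp (Complex.I * (t * ξ * |ξ|))) f

/-- The derivative `∂ₓ` as the Fourier multiplier with symbol `iξ`. -/
def Dx1 (f : ℝ → ℂ) : ℝ → ℂ :=
  FMul (fun ξ => Complex.I * ξ) f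

/-- Projection on nonnegative frequencies. -/
def Pplus (f : ℝ → ℂ) : ℝ → ℂ :=
  FMul (fun ξ => if 0 ≤ ξ then 1 else 0) f

/-- Projection on nonpositive frequencies. -/
def Pminus (f : ℝ → ℂ) : ℝ → ℂ :=
  FMul (fun ξ => if ξ ≤ 0 then 1 else 0) f

/-- The Sobolev `H^s` norm. -/
def HsNorm (s : ℝ) (f : ℝ → ℂ) : ℝ≥0∞ :=
  eLpNorm (fun ξ => (((1 + ξ ^ 2) ^ (s / 2) : ℝ) : ℂ) * 𝓕 f ξ) 2 volume

/-- The mixed space-time norm `L^p_x L^q_T`. -/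
def LpLq (p q : ℝ≥0∞) (T : ℝ) (f : ℝ → ℝ → ℂ) : ℝ≥0∞ :=
  eLpNorm (fun x => (eLpNorm (fun t => f x t) q (volume.restrict (Ioc (0:ℝ) T))).toReal) p volume

/-- The mixed space-time norm `L^q_T L^p_x`. -/
def LqLp (q p : ℝ≥0∞) (T : ℝ) (f : ℝ → ℝ → ℂ) : ℝ≥0∞ :=
  eLpNorm (fun t => (eLpNorm (fun x => f x t) p volume).toReal) q (volume.restrict (Ioc (0:ℝ) T))

/-- The norm `L^∞_T H^s_x`. -/
def LinfHs (s : ℝ) (T : ℝ) (f : ℝ → ℝ → ℂ) : ℝ≥0∞ :=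
  eLpNorm (fun t => (HsNorm s (fun x => f x t)).toReal) ∞ (volume.restrict (Ioc (0:ℝ) T))

/-- Apply a spatial operator slice-wise in time. -/
def sliceOp (A : (ℝ → ℂ) → (ℝ → ℂ)) (f : ℝ → ℝ → ℂ) : ℝ → ℝ → ℂ :=
  fun x t => A (fun y => f y t) x

/-- A smooth nonnegative bump `η` supported in `{1/2 ≤ |ξ| ≤ 2}` giving a dyadic
partition of unity `Σ_k η(2^{-k} ξ) = 1` for `ξ ≠ 0`. -/
structure IsLPBump (η : ℝ → ℝ) : Prop where
  smooth : ContDiff ℝ (⊤ : ℕ∞) η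
  nonneg : ∀ ξ, 0 ≤ η ξ
  support : ∀ ξ, η ξ ≠ 0 → 1/2 ≤ |ξ| ∧ |ξ| ≤ 2
  partition : ∀ ξ : ℝ, ξ ≠ 0 → ∑' k : ℤ, η ((2:ℝ) ^ (-k) * ξ) = 1

/-- The low-frequency symbol `p(ξ) = Σ_{j ≤ -3} η(2^{-j} ξ)`. -/
def lowSymbol (η : ℝ → ℝ) (ξ : ℝ) : ℝ :=
  ∑' j : ℤ, if j ≤ -3 then η ((2:ℝ) ^ (-j) * ξ) else 0

/-- The low-frequency projection `P₀`. -/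
def P0 (η : ℝ → ℝ) (f : ℝ → ℂ) : ℝ → ℂ :=
  FMul (fun ξ => ((lowSymbol η ξ : ℝ) : ℂ)) f

/-- The `X^s_T` norm. -/
def XNorm (η : ℝ → ℝ) (s T : ℝ) (u : ℝ → ℝ → ℂ) : ℝ≥0∞ :=
  LinfHs s T u + LpLq ∞ 2 T (sliceOp (Dop (s + 1/2)) u)
    + LpLq 4 ∞ T (sliceOp (Dop (s - 1/4)) u)
    + LpLq 2 ∞ T (sliceOp (P0 η) u)

/-- The Duhamel integral `∫₀ᵗ V(t-τ) f(τ) dτ`. -/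
def duhamel (f : ℝ → ℝ → ℂ) : ℝ → ℝ → ℂ :=
  fun x t => ∫ τ in Ioc (0:ℝ) t, BOGroup (t - τ) (fun y => f y τ) x

theorem continuous_fourier_of_integrable {f : ℝ → ℂ} (hf : Integrable f) : Continuous (𝓕 f) :=
  VectorFourier.fourierIntegral_continuous Real.continuous_fourierChar
    (L := innerₗ ℝ) (by fun_prop) hf

theorem eLpNorm_fourier_eq {f : ℝ → ℂ} (hf : Integrable f) (hf2 : MemLp f 2 volume) :
    eLpNorm (𝓕 f) 2 volume = eLpNorm f 2 volume := by
  have hae : (𝓕 (hf2.toLp f) : Lp ℂ 2 (volume : Measure ℝ)) =ᵐ[volume] 𝓕 f := by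
    refine ae_eq_of_integral_contDiff_smul_eq
      ((Lp.memLp _).locallyIntegrable (by norm_num)) (continuous_fourier_of_integrable hf).locallyIntegrable ?_
    intro g hg hgc
    have hgc' : HasCompactSupport (Complex.ofRealCLM ∘ g) := hgc.comp_left (by simp)
    have hg' : ContDiff ℝ (⊤ : ℕ∞) (Complex.ofRealCLM ∘ g) := Complex.ofRealCLM.contDiff.comp hg
    have h := DFunLike.congr_fun (Lp.fourier_toTemperedDistribution_eq (hf2.toLp f))
      (hgc'.toSchwartzMap hg')
    rw [TemperedDistribution.fourier_apply, Lp.toTemperedDistribution_apply,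
      Lp.toTemperedDistribution_apply] at h
    have hflip := VectorFourier.integral_fourierIntegral_smul_eq_flip (L := innerₗ ℝ)
      (μ := volume) (ν := volume) Real.continuous_fourierChar (by fun_prop)
      (hgc'.toSchwartzMap hg').integrable hf
    have h1 : ∫ x, (𝓕 (hgc'.toSchwartzMap hg')) x • (hf2.toLp f) x
        = ∫ x, (𝓕 (hgc'.toSchwartzMap hg')) x • f x := by
      refine integral_congr_ae ?_
      filter_upwards [hf2.coeFn_toLp] with x hx
      rw [hx]
    rw [h1] at h
    have h2 := h.symm.trans hflip
    simpa using! h2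
  rw [← eLpNorm_congr_ae hae, ← eLpNorm_congr_ae hf2.coeFn_toLp]
  have := Lp.norm_fourier_eq (hf2.toLp f)
  rw [Lp.norm_def, Lp.norm_def, ENNReal.toReal_eq_toReal_iff' (Lp.eLpNorm_ne_top _)
    (Lp.eLpNorm_ne_top _)] at this
  exact this

theorem eLpNorm_fourierInv_eq {f : ℝ → ℂ} (hf : Integrable f) (hf2 : MemLp f 2 volume) :
    eLpNorm (𝓕⁻ f) 2 volume = eLpNorm f 2 volume := by
  rw [← eLpNorm_fourier_eq hf hf2]
  have : 𝓕⁻ f = 𝓕 f ∘ Neg.neg := by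
    ext x
    exact Real.fourierInv_eq_fourier_neg f x
  rw [this, eLpNorm_comp_measurePreserving (continuous_fourier_of_integrable hf).aestronglyMeasurable
    (Measure.measurePreserving_neg volume)]

theorem memLp_two_of_norm_le_inv_one_add_sq {f : ℝ → ℂ} (hf : Continuous f) {C : ℝ}
    (hC : ∀ x, ‖f x‖ ≤ C * (1 + x ^ 2)⁻¹) : MemLp f 2 volume := by
  rw [memLp_two_iff_integrable_sq_norm hf.aestronglyMeasurable]
  refine (integrable_inv_one_add_sq.const_mul (C ^ 2)).mono' (by fun_prop)
    (Eventually.of_forall fun x => ?_)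
  have h0 : (0 : ℝ) ≤ (1 + x ^ 2)⁻¹ := by positivity
  have h1 : (1 + x ^ 2)⁻¹ ≤ (1 : ℝ) := inv_le_one_of_one_le₀ (by nlinarith [sq_nonneg x])
  rw [norm_pow, norm_norm]
  calc ‖f x‖ ^ 2 ≤ (C * (1 + x ^ 2)⁻¹) ^ 2 := by gcongr; exact hC x
    _ = C ^ 2 * ((1 + x ^ 2)⁻¹ * (1 + x ^ 2)⁻¹) := by ring
    _ ≤ C ^ 2 * ((1 + x ^ 2)⁻¹ * 1) := by gcongr
    _ = _ := by ring

theorem integrable_of_norm_le_inv_one_add_sq {f : ℝ → ℂ} (hf : Continuous f) {C : ℝ}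
    (hC : ∀ x, ‖f x‖ ≤ C * (1 + x ^ 2)⁻¹) : Integrable f :=
  (integrable_inv_one_add_sq.const_mul C).mono' hf.aestronglyMeasurable (Eventually.of_forall hC)

theorem integrable_of_memLp_two_mul {F : ℝ → ℂ} (hF : MemLp F 2 volume)
    (hxF : MemLp (fun x : ℝ => (x : ℂ) * F x) 2 volume) : Integrable F := by
  have hw : MemLp (fun x : ℝ => (1 + Complex.I * x)⁻¹) 2 volume := by
    have hne : ∀ x : ℝ, (1 + Complex.I * x) ≠ 0 := fun x h => by
      simpa using congrArg Complex.re h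
    have hcont : Continuous (fun x : ℝ => (1 + Complex.I * x)⁻¹) :=
      Continuous.inv₀ (by fun_prop) hne
    rw [memLp_two_iff_integrable_sq_norm hcont.aestronglyMeasurable]
    refine integrable_inv_one_add_sq.congr (Eventually.of_forall fun x => ?_)
    simp only [norm_inv, inv_pow, Complex.sq_norm, Complex.normSq_apply]
    simp [pow_two]
  have hs : MemLp (fun x : ℝ => F x + Complex.I * ((x : ℂ) * F x)) 2 volume :=
    hF.add (hxF.const_mul Complex.I)
  refine (hw.integrable_mul hs).congr (Eventually.of_forall fun x => ?_)
  have hne : (1 + Complex.I * x) ≠ 0 := fun h => by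
    simpa using congrArg Complex.re h
  simp only [Pi.mul_apply]
  field_simp

theorem integrable_fourier_of_deriv {g : ℝ → ℂ} (hg : Integrable g) (hg2 : MemLp g 2 volume)
    (hd : Differentiable ℝ g) (hg' : Integrable (deriv g)) (hg'2 : MemLp (deriv g) 2 volume) :
    Integrable (𝓕 g) := by
  have key : ∀ f : ℝ → ℂ, Integrable f → MemLp f 2 volume → MemLp (𝓕 f) 2 volume :=
    fun f h1 h2 => ⟨(continuous_fourier_of_integrable h1).aestronglyMeasurable,
      (eLpNorm_fourier_eq h1 h2).trans_lt h2.2⟩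
  refine integrable_of_memLp_two_mul (key g hg hg2) ?_
  have h := (key _ hg' hg'2).const_mul (2 * π * Complex.I)⁻¹
  rw [Real.fourier_deriv hg hd hg'] at h
  refine h.congr_norm (by
    have := continuous_fourier_of_integrable hg
    exact Continuous.aestronglyMeasurable (by fun_prop)) (Eventually.of_forall fun x => ?_)
  have : (2 * π * Complex.I) ≠ 0 := by simp [Real.pi_ne_zero]
  congr 1
  simp only [smul_eq_mul]
  field_simp

theorem lowSymbol_nonneg {η : ℝ → ℝ} (hη : IsLPBump η) (ξ : ℝ) : 0 ≤ lowSymbol η ξ :=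
  tsum_nonneg fun j => by split_ifs <;> simp [hη.nonneg]

theorem measurable_lowSymbol {η : ℝ → ℝ} (hη : IsLPBump η) : Measurable (lowSymbol η) := by
  have h : lowSymbol η = fun ξ => (∑' j : ℤ,
      ENNReal.ofReal (if j ≤ -3 then η ((2 : ℝ) ^ (-j) * ξ) else 0)).toReal := by
    ext ξ
    rw [ENNReal.tsum_toReal_eq (fun _ => ENNReal.ofReal_ne_top)]
    refine tsum_congr fun j => (ENNReal.toReal_ofReal ?_).symm
    split_ifs <;> simp [hη.nonneg]
  rw [h]
  refine (Measurable.tsum fun j => ENNReal.measurable_ofReal.comp ?_).ennreal_toReal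
  have := hη.smooth.continuous
  split_ifs
  · exact (by fun_prop : Continuous fun ξ => η ((2 : ℝ) ^ (-j) * ξ)).measurable
  · exact measurable_const

theorem lowSymbol_zero {η : ℝ → ℝ} (hη : IsLPBump η) : lowSymbol η 0 = 0 := by
  have h0 : η 0 = 0 := by
    by_contra h
    have := (hη.support 0 h).1
    norm_num at this
  simp [lowSymbol, h0]

theorem lowSymbol_le_one {η : ℝ → ℝ} (hη : IsLPBump η) (ξ : ℝ) : lowSymbol η ξ ≤ 1 := by
  rcases eq_or_ne ξ 0 with rfl | hξ
  · simp [lowSymbol_zero hη]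
  have hp := hη.partition ξ hξ
  have hs : Summable fun k : ℤ => η ((2 : ℝ) ^ (-k) * ξ) := by
    by_contra h
    rw [tsum_eq_zero_of_not_summable h] at hp
    norm_num at hp
  have hle : ∀ j : ℤ, (if j ≤ -3 then η ((2 : ℝ) ^ (-j) * ξ) else 0)
      ≤ η ((2 : ℝ) ^ (-j) * ξ) := fun j => by split_ifs <;> simp [hη.nonneg]
  rw [← hp]
  exact (hs.of_nonneg_of_le (fun j => by split_ifs <;> simp [hη.nonneg]) hle).tsum_le_tsum hle hs

theorem abs_le_of_lowSymbol_ne_zero {η : ℝ → ℝ} (hη : IsLPBump η) {ξ : ℝ}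
    (h : lowSymbol η ξ ≠ 0) : |ξ| ≤ 1 / 4 := by
  by_contra! hξ
  refine h ((tsum_congr fun j => ?_).trans tsum_zero)
  split_ifs with hj
  · by_contra hne
    have h2 := (hη.support _ hne).2
    rw [abs_mul, abs_of_pos (by positivity : (0 : ℝ) < 2 ^ (-j))] at h2
    have h8 : (2 : ℝ) ^ (3 : ℤ) ≤ 2 ^ (-j) := zpow_le_zpow_right₀ (by norm_num) (by omega)
    have h8' : (2 : ℝ) ^ (3 : ℤ) = 8 := by norm_num
    nlinarith [abs_nonneg ξ]
  · rfl

theorem hasDerivAt_mul_abs (ξ : ℝ) : HasDerivAt (fun x : ℝ => x * |x|) (2 * |ξ|) ξ := by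
  rcases lt_trichotomy ξ 0 with h | rfl | h
  · rw [abs_of_neg h]
    refine (((hasDerivAt_id ξ).pow 2).neg.congr_of_eventuallyEq ?_).congr_deriv
      (by simp)
    filter_upwards [gt_mem_nhds h] with x hx
    simp [abs_of_neg hx, pow_two]
  · rw [hasDerivAt_iff_tendsto_slope_zero]
    have : Tendsto (fun t : ℝ => |t|) (𝓝[≠] 0) (𝓝 (2 * |(0 : ℝ)|)) := by
      simpa using (continuous_abs.tendsto (0 : ℝ)).mono_left nhdsWithin_le_nhds
    refine this.congr' ?_
    filter_upwards [self_mem_nhdsWithin] with t ht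
    have : t ≠ 0 := ht
    simp [this]
  · rw [abs_of_pos h]
    refine (((hasDerivAt_id ξ).pow 2).congr_of_eventuallyEq ?_).congr_deriv
      (by simp)
    filter_upwards [lt_mem_nhds h] with x hx
    simp [abs_of_pos hx, pow_two]

theorem exists_norm_le_inv_one_add_sq (f : SchwartzMap ℝ ℂ) (k : ℕ) :
    ∃ C : ℝ, ∀ x, |x| ^ k * ‖f x‖ ≤ C * (1 + x ^ 2)⁻¹ := by
  obtain ⟨C₁, h₁⟩ := f.decay k 0
  obtain ⟨C₂, h₂⟩ := f.decay (k + 2) 0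
  refine ⟨C₁ + C₂, fun x => ?_⟩
  rw [← div_eq_mul_inv, le_div_iff₀ (by positivity)]
  have h1 := h₁.2 x
  have h2 := h₂.2 x
  simp only [norm_iteratedFDeriv_zero, Real.norm_eq_abs, pow_add, sq_abs] at h1 h2
  linarith

theorem norm_exp_I_mul (t ξ : ℝ) : ‖Complex.exp (Complex.I * (t * ξ * |ξ|))‖ = 1 := by
  have : Complex.I * (t * ξ * |ξ|) = ((t * ξ * |ξ| : ℝ) : ℂ) * Complex.I := by
    push_cast; ring
  rw [this, Complex.norm_exp_ofReal_mul_I]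

theorem fourier_BOGroup (t : ℝ) (φ : SchwartzMap ℝ ℂ) :
    𝓕 (BOGroup t φ) = fun ξ : ℝ => Complex.exp (Complex.I * (t * ξ * |ξ|)) * 𝓕 (φ : ℝ → ℂ) ξ := by
  have hψ : 𝓕 (φ : ℝ → ℂ) = (𝓕 φ : SchwartzMap ℝ ℂ) := SchwartzMap.fourier_coe φ
  rw [BOGroup, FMul, hψ]
  set ψ : SchwartzMap ℝ ℂ := 𝓕 φ
  set g : ℝ → ℂ := fun ξ : ℝ => Complex.exp (Complex.I * (t * ξ * |ξ|)) * ψ ξ with hg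
  set χ : SchwartzMap ℝ ℂ := SchwartzMap.derivCLM ℝ ℂ ψ with hχ
  have hderiv : ∀ ξ : ℝ, HasDerivAt g (Complex.exp (Complex.I * (t * ξ * |ξ|)) *
      (2 * Complex.I * t * |ξ| * ψ ξ + χ ξ)) ξ := by
    intro ξ
    have h1 := ((hasDerivAt_mul_abs ξ).ofReal_comp.const_mul (Complex.I * t)).cexp
    have h2 : HasDerivAt ψ (χ ξ) ξ := by
      rw [hχ, SchwartzMap.derivCLM_apply]
      exact ψ.differentiableAt.hasDerivAt
    have h3 := h1.mul h2
    refine (h3.congr_of_eventuallyEq (Eventually.of_forall fun x => ?_)).congr_deriv ?_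
    · simp only [hg, Pi.mul_apply]
      push_cast
      congr 2
      ring
    · push_cast
      simp only [mul_assoc]
      ring
  have hψc := ψ.continuous
  have hχc := χ.continuous
  have hdeq : deriv g = fun ξ : ℝ => Complex.exp (Complex.I * (t * ξ * |ξ|)) *
      (2 * Complex.I * t * |ξ| * ψ ξ + χ ξ) := funext fun ξ => (hderiv ξ).deriv
  have hgc : Continuous g := by fun_prop
  have hdc : Continuous (deriv g) := by rw [hdeq]; fun_prop
  obtain ⟨C₀, h₀⟩ := exists_norm_le_inv_one_add_sq ψ 0
  obtain ⟨C₁, h₁⟩ := exists_norm_le_inv_one_add_sq ψ 1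
  obtain ⟨C₂, h₂⟩ := exists_norm_le_inv_one_add_sq χ 0
  have hgb : ∀ x, ‖g x‖ ≤ C₀ * (1 + x ^ 2)⁻¹ := fun x => by
    rw [hg, norm_mul, norm_exp_I_mul]
    simpa using h₀ x
  have hdb : ∀ x, ‖deriv g x‖ ≤ (2 * |t| * C₁ + C₂) * (1 + x ^ 2)⁻¹ := fun x => by
    rw [hdeq, norm_mul, norm_exp_I_mul, one_mul]
    refine (norm_add_le _ _).trans ?_
    have e : ‖2 * Complex.I * t * |x| * ψ x‖ = 2 * |t| * (|x| ^ 1 * ‖ψ x‖) := by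
      simp; ring
    rw [e, add_mul, mul_assoc (2 * |t|)]
    exact add_le_add (mul_le_mul_of_nonneg_left (h₁ x) (by positivity)) (by simpa using h₂ x)
  have hgi := integrable_of_norm_le_inv_one_add_sq hgc hgb
  exact hgc.fourier_fourierInv_eq hgi
    (integrable_fourier_of_deriv hgi (memLp_two_of_norm_le_inv_one_add_sq hgc hgb)
      (fun ξ => (hderiv ξ).differentiableAt) (integrable_of_norm_le_inv_one_add_sq hdc hdb)
      (memLp_two_of_norm_le_inv_one_add_sq hdc hdb))

theorem norm_mul_abs_mul_le {h : ℝ → ℂ} (hs : ∀ ξ, h ξ ≠ 0 → |ξ| ≤ 1) (ξ : ℝ) :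
    ‖Complex.I * (ξ * |ξ|) * h ξ‖ ≤ ‖h ξ‖ := by
  by_cases h0 : h ξ = 0
  · simp [h0]
  · have h1 := hs ξ h0
    have : |ξ| * |ξ| ≤ 1 := by nlinarith [abs_nonneg ξ]
    simpa using mul_le_of_le_one_left (norm_nonneg (h ξ)) this

theorem aestronglyMeasurable_char_smul_exp_mul {h : ℝ → ℂ} (hh : AEStronglyMeasurable h volume)
    (t x : ℝ) : AEStronglyMeasurable (fun ξ : ℝ =>
      Complex.exp (↑(2 * π * inner ℝ ξ x) * Complex.I) •
        (Complex.exp (Complex.I * (t * ξ * |ξ|)) * h ξ)) volume := by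
  have h1 : Continuous fun ξ : ℝ => Complex.exp (↑(2 * π * inner ℝ ξ x) * Complex.I) := by
    fun_prop
  have h2 : Continuous fun ξ : ℝ => Complex.exp (Complex.I * (t * ξ * |ξ|)) := by fun_prop
  exact h1.aestronglyMeasurable.smul (h2.aestronglyMeasurable.mul hh)

theorem continuous_fourierInv_exp_mul {h : ℝ → ℂ} (hh : Integrable h) :
    Continuous fun q : ℝ × ℝ =>
      𝓕⁻ (fun ξ : ℝ => Complex.exp (Complex.I * (q.1 * ξ * |ξ|)) * h ξ) q.2 := by
  simp only [Real.fourierInv_eq']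
  refine continuous_of_dominated (bound := fun ξ => ‖h ξ‖) (fun q => ?_) (fun q => ?_) hh.norm ?_
  · exact aestronglyMeasurable_char_smul_exp_mul hh.aestronglyMeasurable q.1 q.2
  · refine Eventually.of_forall fun ξ => ?_
    rw [norm_smul, norm_mul, norm_exp_I_mul, Complex.norm_exp_ofReal_mul_I, one_mul, one_mul]
  · exact Eventually.of_forall fun ξ => by simp only [RCLike.inner_apply]; fun_prop

theorem integrable_mul_abs_mul {h : ℝ → ℂ} (hh : Integrable h)
    (hs : ∀ ξ, h ξ ≠ 0 → |ξ| ≤ 1) : Integrable fun ξ : ℝ => Complex.I * (ξ * |ξ|) * h ξ := by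
  refine hh.mono ((Continuous.aestronglyMeasurable (by fun_prop)).mul hh.aestronglyMeasurable)
    (Eventually.of_forall fun ξ => norm_mul_abs_mul_le hs ξ)

theorem hasDerivAt_fourierInv_exp_mul {h : ℝ → ℂ} (hh : Integrable h)
    (hs : ∀ ξ, h ξ ≠ 0 → |ξ| ≤ 1) (x t : ℝ) :
    HasDerivAt (fun s : ℝ => 𝓕⁻ (fun ξ : ℝ => Complex.exp (Complex.I * (s * ξ * |ξ|)) * h ξ) x)
      (𝓕⁻ (fun ξ : ℝ => Complex.exp (Complex.I * (t * ξ * |ξ|)) *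
        (Complex.I * (ξ * |ξ|) * h ξ)) x) t := by
  simp only [Real.fourierInv_eq']
  refine (hasDerivAt_integral_of_dominated_loc_of_deriv_le (bound := fun ξ => ‖h ξ‖)
    (F' := fun s ξ => Complex.exp (↑(2 * π * inner ℝ ξ x) * Complex.I) •
      (Complex.exp (Complex.I * (s * ξ * |ξ|)) * (Complex.I * (ξ * |ξ|) * h ξ)))
    (Metric.ball_mem_nhds t one_pos) (Eventually.of_forall fun s =>
      aestronglyMeasurable_char_smul_exp_mul hh.aestronglyMeasurable s x) ?_ ?_ ?_ hh.norm ?_).2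
  · refine hh.mono (aestronglyMeasurable_char_smul_exp_mul hh.aestronglyMeasurable t x)
      (Eventually.of_forall fun ξ => ?_)
    rw [norm_smul, norm_mul, norm_exp_I_mul, Complex.norm_exp_ofReal_mul_I, one_mul, one_mul]
  · exact aestronglyMeasurable_char_smul_exp_mul
      (integrable_mul_abs_mul hh hs).aestronglyMeasurable t x
  · refine Eventually.of_forall fun ξ s _ => ?_
    rw [norm_smul, norm_mul, norm_exp_I_mul, Complex.norm_exp_ofReal_mul_I, one_mul, one_mul]
    exact norm_mul_abs_mul_le hs ξ
  · refine Eventually.of_forall fun ξ s _ => ?_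
    have h1 : HasDerivAt (fun s : ℝ => Complex.I * ((s : ℂ) * ξ * |ξ|))
        (Complex.I * (ξ * |ξ|)) s := by
      have := (((hasDerivAt_id s).ofReal_comp.mul_const (ξ : ℂ)).mul_const
        ((|ξ| : ℝ) : ℂ)).const_mul Complex.I
      simpa using! this
    refine ((h1.cexp.mul_const (h ξ)).const_smul
      (Complex.exp (↑(2 * π * inner ℝ ξ x) * Complex.I))).congr_deriv ?_
    rw [mul_assoc (Complex.exp _)]

theorem enorm_fourierInv_exp_mul_le {h : ℝ → ℂ} (hh : Integrable h)
    (hs : ∀ ξ, h ξ ≠ 0 → |ξ| ≤ 1) (x : ℝ) {t : ℝ} (ht : t ∈ Ioc (0 : ℝ) 1) :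
    ‖𝓕⁻ (fun ξ : ℝ => Complex.exp (Complex.I * (t * ξ * |ξ|)) * h ξ) x‖ₑ ≤
      ‖𝓕⁻ h x‖ₑ + ∫⁻ s in Ioc (0 : ℝ) 1,
        ‖𝓕⁻ (fun ξ : ℝ => Complex.exp (Complex.I * (s * ξ * |ξ|)) *
          (Complex.I * (ξ * |ξ|) * h ξ)) x‖ₑ := by
  have hc := (continuous_fourierInv_exp_mul (integrable_mul_abs_mul hh hs)).comp
    (by fun_prop : Continuous fun s : ℝ => (s, x))
  have hftc := intervalIntegral.integral_eq_sub_of_hasDerivAt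
    (fun s _ => hasDerivAt_fourierInv_exp_mul hh hs x s)
    (hc.intervalIntegrable 0 t)
  have h0 : (fun ξ : ℝ => Complex.exp (Complex.I * (((0 : ℝ) : ℂ) * ξ * |ξ|)) * h ξ) = h := by
    simp
  rw [h0, intervalIntegral.integral_of_le ht.1.le] at hftc
  rw [← add_sub_cancel (𝓕⁻ h x)
    (𝓕⁻ (fun ξ : ℝ => Complex.exp (Complex.I * (t * ξ * |ξ|)) * h ξ) x), ← hftc]
  refine (enorm_add_le _ _).trans ?_
  gcongr
  refine (enorm_integral_le_lintegral_enorm _).trans ?_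
  exact lintegral_mono_set (Ioc_subset_Ioc_right ht.2)

theorem eLpNorm_two_sq {α : Type*} [MeasurableSpace α] (μ : Measure α) (g : α → ℝ≥0∞) :
    eLpNorm g 2 μ ^ 2 = ∫⁻ a, g a ^ 2 ∂μ := by
  rw [eLpNorm_eq_lintegral_rpow_enorm_toReal two_ne_zero ENNReal.ofNat_ne_top,
    ← ENNReal.rpow_natCast, ← ENNReal.rpow_mul]
  simp

theorem eLpNorm_two_lintegral_le {α β : Type*} [MeasurableSpace α] [MeasurableSpace β]
    {μ : Measure α} [SFinite μ] {ν : Measure β} [IsProbabilityMeasure ν] {f : α → β → ℝ≥0∞}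
    (hf : Measurable (Function.uncurry f)) {N : ℝ≥0∞}
    (hN : ∀ b, eLpNorm (fun a => f a b) 2 μ ≤ N) :
    eLpNorm (fun a => ∫⁻ b, f a b ∂ν) 2 μ ≤ N := by
  refine (ENNReal.pow_le_pow_left_iff two_ne_zero).1 ?_
  rw [eLpNorm_two_sq]
  calc ∫⁻ a, (∫⁻ b, f a b ∂ν) ^ 2 ∂μ ≤ ∫⁻ a, ∫⁻ b, f a b ^ 2 ∂ν ∂μ := by
        refine lintegral_mono fun a => ?_
        rw [← eLpNorm_two_sq]
        gcongr
        have hfa : Measurable (f a) := hf.comp measurable_prodMk_left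
        have := eLpNorm_le_eLpNorm_of_exponent_le (μ := ν) (p := 1) (q := 2) (by norm_num)
          hfa.aestronglyMeasurable
        rwa [eLpNorm_one_eq_lintegral_enorm] at this
    _ = ∫⁻ b, ∫⁻ a, f a b ^ 2 ∂μ ∂ν :=
        lintegral_lintegral_swap (hf.pow_const 2).aemeasurable
    _ ≤ ∫⁻ _, N ^ 2 ∂ν := by
        refine lintegral_mono fun b => ?_
        rw [← eLpNorm_two_sq]
        gcongr
        exact hN b
    _ = N ^ 2 := by simp

theorem LpLq_two_top_fourierInv_exp_mul_le {h : ℝ → ℂ} (hh : Integrable h)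
    (hh2 : MemLp h 2 volume) (hs : ∀ ξ, h ξ ≠ 0 → |ξ| ≤ 1) {T : ℝ} (hT : T ≤ 1) :
    LpLq 2 ∞ T (fun x t =>
        𝓕⁻ (fun ξ : ℝ => Complex.exp (Complex.I * (t * ξ * |ξ|)) * h ξ) x) ≤
      2 * eLpNorm h 2 volume := by
  have hk := integrable_mul_abs_mul hh hs
  have hv := continuous_fourierInv_exp_mul hk
  have hu : Continuous (𝓕⁻ h) := by
    have := (continuous_fourierInv_exp_mul hh).comp
      (by fun_prop : Continuous fun x : ℝ => ((0 : ℝ), x))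
    simpa [Function.comp_def] using this
  set v : ℝ → ℝ → ℂ := fun x s => 𝓕⁻ (fun ξ : ℝ => Complex.exp (Complex.I * (s * ξ * |ξ|)) *
    (Complex.I * (ξ * |ξ|) * h ξ)) x with hvdef
  have hvm : Measurable (Function.uncurry fun x s => ‖v x s‖ₑ) :=
    (hv.comp continuous_swap).measurable.enorm
  have hpt : ∀ x, ‖(eLpNorm (fun t : ℝ => 𝓕⁻ (fun ξ : ℝ =>
      Complex.exp (Complex.I * (t * ξ * |ξ|)) * h ξ) x) ∞
      (volume.restrict (Ioc (0 : ℝ) T))).toReal‖ₑ ≤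
      ‖‖𝓕⁻ h x‖ₑ + ∫⁻ s in Ioc (0 : ℝ) 1, ‖v x s‖ₑ‖ₑ := fun x => by
    rw [enorm_eq_self, Real.enorm_of_nonneg ENNReal.toReal_nonneg]
    refine ENNReal.ofReal_toReal_le.trans ?_
    rw [eLpNorm_exponent_top]
    refine eLpNormEssSup_le_of_ae_enorm_bound ?_
    filter_upwards [ae_restrict_mem measurableSet_Ioc] with t ht
    exact enorm_fourierInv_exp_mul_le hh hs x ⟨ht.1, ht.2.trans hT⟩
  have : IsProbabilityMeasure (volume.restrict (Ioc (0 : ℝ) 1)) := ⟨by simp⟩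
  refine (eLpNorm_mono_enorm hpt).trans ((eLpNorm_add_le
    hu.enorm.measurable.aestronglyMeasurable
    (hvm.lintegral_prod_right').aestronglyMeasurable (by norm_num)).trans ?_)
  rw [two_mul]
  gcongr
  · rw [eLpNorm_enorm, eLpNorm_fourierInv_eq hh hh2]
  · refine eLpNorm_two_lintegral_le hvm fun s => ?_
    have hle : ∀ ξ : ℝ, ‖Complex.exp (Complex.I * (s * ξ * |ξ|)) *
        (Complex.I * (ξ * |ξ|) * h ξ)‖ ≤ ‖h ξ‖ := fun ξ => by
      rw [norm_mul, norm_exp_I_mul, one_mul]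
      exact norm_mul_abs_mul_le hs ξ
    have hm : AEStronglyMeasurable (fun ξ : ℝ => Complex.exp (Complex.I * (s * ξ * |ξ|)) *
        (Complex.I * (ξ * |ξ|) * h ξ)) volume :=
      (Continuous.aestronglyMeasurable (by fun_prop)).mul hk.aestronglyMeasurable
    rw [eLpNorm_enorm, hvdef, eLpNorm_fourierInv_eq (hh.mono hm (Eventually.of_forall hle))
      (hh2.mono hm (Eventually.of_forall hle))]
    exact eLpNorm_mono hle

/-- **Low-frequency maximal estimate.**
For every `φ ∈ 𝒮(ℝ)` and every `0 < T < 1`,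
`‖P₀ V(t) φ‖_{L^2_x L^∞_T} ≲ ‖P₀ φ‖_{L²}`, with implicit constant independent
of `φ` and `T`. -/
theorem low_frequency_maximal_BO (η : ℝ → ℝ) (hη : IsLPBump η) :
    ∃ C : ℝ≥0, 0 < C ∧ ∀ (φ : SchwartzMap ℝ ℂ) (T : ℝ), 0 < T → T < 1 →
      LpLq 2 ∞ T (fun x t => P0 η (BOGroup t ⇑φ) x)
        ≤ C * eLpNorm (P0 η ⇑φ) 2 volume := by
  refine ⟨2, two_pos, fun φ T _ hT => ?_⟩
  have hψ : 𝓕 (φ : ℝ → ℂ) = (𝓕 φ : SchwartzMap ℝ ℂ) := SchwartzMap.fourier_coe φ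
  set ψ : SchwartzMap ℝ ℂ := 𝓕 φ
  set h : ℝ → ℂ := fun ξ => (lowSymbol η ξ : ℂ) * ψ ξ with hdef
  have hm : AEStronglyMeasurable h volume :=
    (Complex.measurable_ofReal.comp (measurable_lowSymbol hη)).aestronglyMeasurable.mul
      ψ.continuous.aestronglyMeasurable
  have hle : ∀ ξ, ‖h ξ‖ ≤ ‖ψ ξ‖ := fun ξ => by
    rw [hdef, norm_mul, Complex.norm_real, Real.norm_of_nonneg (lowSymbol_nonneg hη ξ)]
    exact mul_le_of_le_one_left (norm_nonneg _) (lowSymbol_le_one hη ξ)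
  have hh : Integrable h := ψ.integrable.mono hm (Eventually.of_forall hle)
  have hh2 : MemLp h 2 volume := (ψ.memLp 2 volume).mono hm (Eventually.of_forall hle)
  have hs : ∀ ξ, h ξ ≠ 0 → |ξ| ≤ 1 := fun ξ hξ => by
    have : lowSymbol η ξ ≠ 0 := fun h0 => hξ (by simp [hdef, h0])
    linarith [abs_le_of_lowSymbol_ne_zero hη this]
  have hL : (fun x t => P0 η (BOGroup t φ) x) = fun (x t : ℝ) =>
      𝓕⁻ (fun ξ : ℝ => Complex.exp (Complex.I * (t * ξ * |ξ|)) * h ξ) x := by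
    ext x t
    rw [P0, FMul, fourier_BOGroup, hψ]
    refine congrArg (fun f : ℝ → ℂ => (𝓕⁻ f : ℝ → ℂ) x) (funext fun ξ => ?_)
    rw [hdef]
    ring
  have hR : P0 η φ = 𝓕⁻ h := by rw [P0, FMul, hψ]
  rw [hL, hR, eLpNorm_fourierInv_eq hh hh2]
  exact LpLq_two_top_fourierInv_exp_mul_le hh hh2 hs hT.le

end
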